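/- arXiv:2204.05032 — 2 statements merged into one kernel-verified Lean document; each statement's English description precedes it below -/
import Mathlib

section
/- If φ : [0,∞)² → ℝ has the form φ(x,t) = ∫_{[0,∞)²} Ω_d(xξ) Ω_{d'}(tv) dH(ξ,v) for a probability measure H on [0,∞)², then the kernel ((x,s),(y,t)) ↦ φ(‖x−y‖, ‖s−t‖) on (ℝ^d × ℝ^{d'})² is positive definite and φ(0,0) = 1. -/
open MeasureTheory

/-- The Schoenberg kernel `Ω_d` via its power series. -/
noncomputable def Omega (d : ℕ) (x : ℝ) : ℝ :=
  ∑' n : ℕ, Real.Gamma ((d : ℝ) / 2) * (-(x ^ 2 / 4)) ^ n /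
    (Real.Gamma ((d : ℝ) / 2 + n) * n.factorial)

theorem Real.Gamma_nat_add_half_mul (n : ℕ) :
    Real.Gamma (n + 1 / 2) * (4 ^ n * n.factorial) = (2 * n).factorial * √Real.pi := by
  induction n with
  | zero => simp [← Real.Gamma_one_half_eq]
  | succ n ih =>
    have h : Real.Gamma ((n : ℝ) + 1 + 1 / 2) = (n + 1 / 2) * Real.Gamma (n + 1 / 2) := by
      rw [← Real.Gamma_add_one (by positivity)]
      ring_nf
    rw [show 2 * (n + 1) = 2 * n + 1 + 1 by ring]
    simp only [Nat.factorial_succ]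
    push_cast
    rw [h]
    linear_combination (4 * (n + 1 / 2) * (n + 1)) * ih

theorem integral_Ioi_pow_mul_exp_neg_sq (k : ℕ) :
    ∫ r in Set.Ioi (0 : ℝ), r ^ k * Real.exp (-r ^ 2) = Real.Gamma ((k + 1) / 2) / 2 := by
  have h := integral_rpow_mul_exp_neg_rpow (p := 2) (q := k) (by norm_num)
    (by have := k.cast_nonneg (α := ℝ); linarith)
  simp only [Real.rpow_natCast, Real.rpow_ofNat] at h
  rw [h]
  ring

theorem integral_pow_mul_exp_neg_sq (n : ℕ) :
    ∫ r : ℝ, r ^ (2 * n) * Real.exp (-r ^ 2) = Real.Gamma (n + 1 / 2) := by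
  have h := integral_comp_abs (f := fun r : ℝ => r ^ (2 * n) * Real.exp (-r ^ 2))
  simp only [sq_abs, (even_two_mul n).pow_abs] at h
  rw [h, integral_Ioi_pow_mul_exp_neg_sq]
  push_cast
  ring_nf

theorem integral_polar {E : Type*} [NormedAddCommGroup E] [NormedSpace ℝ E]
    [MeasurableSpace E] [BorelSpace E] [FiniteDimensional ℝ E] [Nontrivial E]
    (μ : Measure E) [Measure.IsAddHaarMeasure μ] (F : E → ℝ) (f : Metric.sphere (0 : E) 1 → ℝ)
    (g : ℝ → ℝ) (hF : ∀ r, 0 < r → ∀ η : Metric.sphere (0 : E) 1, F (r • (η : E)) = f η * g r) :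
    ∫ x, F x ∂μ = (∫ η, f η ∂μ.toSphere) *
      ∫ r in Set.Ioi (0 : ℝ), r ^ (Module.finrank ℝ E - 1) * g r := by
  calc
    ∫ x, F x ∂μ = ∫ x : ({(0)}ᶜ : Set E), F x.1 ∂(μ.comap (↑)) := by
      rw [integral_subtype_comap (measurableSet_singleton _).compl F,
        restrict_compl_singleton]
    _ = ∫ x : ({(0)}ᶜ : Set E), (fun p : Metric.sphere (0 : E) 1 × Set.Ioi (0 : ℝ) => f p.1 * g p.2)
          (homeomorphUnitSphereProd E x) ∂(μ.comap (↑)) := by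
      refine integral_congr_ae (.of_forall fun x => ?_)
      simp only
      rw [← hF _ (homeomorphUnitSphereProd E x).2.2]
      have hx : ‖(x : E)‖ ≠ 0 := norm_ne_zero_iff.2 x.2
      simp [smul_smul, hx]
    _ = ∫ p, f p.1 * g p.2 ∂μ.toSphere.prod (.volumeIoiPow (Module.finrank ℝ E - 1)) :=
      μ.measurePreserving_homeomorphUnitSphereProd.integral_comp
        (Homeomorph.measurableEmbedding _)
        (fun p : Metric.sphere (0 : E) 1 × Set.Ioi (0 : ℝ) => f p.1 * g p.2)
    _ = (∫ η, f η ∂μ.toSphere) *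
        ∫ r : Set.Ioi (0 : ℝ), g r ∂.volumeIoiPow (Module.finrank ℝ E - 1) :=
      integral_prod_mul f (fun r : Set.Ioi (0 : ℝ) => g r)
    _ = _ := by
      simp only [Measure.volumeIoiPow, ENNReal.ofReal]
      rw [integral_withDensity_eq_integral_smul,
        integral_subtype_comap measurableSet_Ioi fun a ↦
          Real.toNNReal (a ^ (Module.finrank ℝ E - 1)) • g a,
        setIntegral_congr_fun measurableSet_Ioi fun x hx ↦ ?_]
      · simp only [NNReal.smul_def, Real.coe_toNNReal _ (pow_nonneg (le_of_lt hx) _), smul_eq_mul]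
      · exact (measurable_subtype_coe.pow_const _).real_toNNReal

theorem integral_inner_pow_mul_exp_neg_norm_sq (m n : ℕ) (x : EuclideanSpace ℝ (Fin (m + 1))) :
    ∫ y : EuclideanSpace ℝ (Fin (m + 1)), inner ℝ x y ^ (2 * n) * Real.exp (-‖y‖ ^ 2) =
      ‖x‖ ^ (2 * n) * (Real.Gamma (n + 1 / 2) * √Real.pi ^ m) := by
  set e : EuclideanSpace ℝ (Fin (m + 1)) := EuclideanSpace.single 0 ‖x‖ with he
  have hnorm : ‖x‖ = ‖e‖ := by simp [he]
  let R := (ℝ ∙ (x - e))ᗮ.reflection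
  have hR : R x = e := Submodule.reflection_sub hnorm
  calc
    _ = ∫ y, inner ℝ e (R y) ^ (2 * n) * Real.exp (-‖R y‖ ^ 2) := by
      simp only [← hR, LinearIsometryEquiv.inner_map_map, LinearIsometryEquiv.norm_map]
    _ = ∫ y, inner ℝ e y ^ (2 * n) * Real.exp (-‖y‖ ^ 2) :=
      R.measurePreserving.integral_comp R.toHomeomorph.measurableEmbedding
        (fun y => inner ℝ e y ^ (2 * n) * Real.exp (-‖y‖ ^ 2))
    _ = ∫ y : Fin (m + 1) → ℝ, ‖x‖ ^ (2 * n) *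
        ∏ i, (y i ^ (if i = 0 then 2 * n else 0) * Real.exp (-y i ^ 2)) := by
      rw [← (PiLp.volume_preserving_toLp (Fin (m + 1))).integral_comp
        (MeasurableEquiv.toLp 2 _).measurableEmbedding]
      refine integral_congr_ae (.of_forall fun y => ?_)
      simp only [EuclideanSpace.real_norm_sq_eq, he, EuclideanSpace.inner_single_left,
        Finset.prod_mul_distrib, ← Real.exp_sum, Finset.sum_neg_distrib, pow_ite, pow_zero,
        Finset.prod_ite_eq', Finset.mem_univ, if_true, mul_pow, mul_assoc]
      simp
    _ = _ := by
      rw [integral_const_mul, integral_fintype_prod_volume_eq_prod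
        (f := fun (i : Fin (m + 1)) (t : ℝ) =>
          t ^ (if i = 0 then 2 * n else 0) * Real.exp (-t ^ 2)), Fin.prod_univ_succ]
      have h := integral_pow_mul_exp_neg_sq 0
      simp only [mul_zero, pow_zero, one_mul, Nat.cast_zero, zero_add, Real.Gamma_one_half_eq] at h
      simp [integral_pow_mul_exp_neg_sq, Fin.succ_ne_zero, h]

theorem integral_toSphere_inner_pow {d : ℕ} (hd : 0 < d) (n : ℕ) (x : EuclideanSpace ℝ (Fin d)) :
    ∫ η : Metric.sphere (0 : EuclideanSpace ℝ (Fin d)) 1, inner ℝ x (η : EuclideanSpace ℝ (Fin d))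
        ^ (2 * n) ∂(volume : Measure (EuclideanSpace ℝ (Fin d))).toSphere =
      ‖x‖ ^ (2 * n) * (2 * √Real.pi ^ (d - 1) * Real.Gamma (n + 1 / 2) /
        Real.Gamma (d / 2 + n)) := by
  obtain ⟨m, rfl⟩ := Nat.exists_eq_add_one.2 hd
  simp only [Nat.add_sub_cancel]
  have hpolar := integral_polar (volume : Measure (EuclideanSpace ℝ (Fin (m + 1))))
    (fun y => inner ℝ x y ^ (2 * n) * Real.exp (-‖y‖ ^ 2)) (fun η => inner ℝ x (η : EuclideanSpace ℝ (Fin (m + 1))) ^ (2 * n))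
    (fun r => r ^ (2 * n) * Real.exp (-r ^ 2)) fun r hr η => by
      simp [inner_smul_right, norm_smul, mul_pow]
      ring
  have hpos : 0 < Real.Gamma (((m + 1 : ℕ) : ℝ) / 2 + n) := Real.Gamma_pos_of_pos (by positivity)
  simp only [← mul_assoc, ← pow_add, integral_Ioi_pow_mul_exp_neg_sq,
    integral_inner_pow_mul_exp_neg_norm_sq, finrank_euclideanSpace_fin, Nat.add_sub_cancel] at hpolar
  rw [show (((m + 2 * n : ℕ) : ℝ) + 1) / 2 = ((m + 1 : ℕ) : ℝ) / 2 + n by push_cast; ring] at hpolar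
  rw [← mul_div_assoc, eq_div_iff hpos.ne']
  linear_combination -2 * hpolar

theorem hasSum_integral_cos {X : Type*} [MeasurableSpace X] (μ : Measure X) [IsFiniteMeasure μ]
    {f : X → ℝ} (hf : AEStronglyMeasurable f μ) {C : ℝ} (hC : ∀ a, |f a| ≤ C) :
    HasSum (fun n : ℕ => ∫ a, (-1) ^ n * f a ^ (2 * n) / (2 * n).factorial ∂μ)
      (∫ a, Real.cos (f a) ∂μ) := by
  refine hasSum_integral_of_dominated_convergence
    (fun n _ => C ^ (2 * n) / ((2 * n).factorial : ℝ)) (fun n => ?_) (fun n => .of_forall fun a => ?_)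
    (.of_forall fun _ => (Real.hasSum_cosh C).summable) (integrable_const _)
    (.of_forall fun a => Real.hasSum_cos (f a))
  · simp only [div_eq_mul_inv]
    exact ((hf.pow _).const_mul _).mul_const _
  · rw [norm_div, norm_mul, norm_pow, norm_pow, norm_neg, norm_one, one_pow, one_mul,
      Real.norm_eq_abs, RCLike.norm_natCast]
    gcongr
    exact hC a

theorem integral_toSphere_cos_inner {d : ℕ} (hd : 0 < d) (x : EuclideanSpace ℝ (Fin d)) :
    ∫ η : Metric.sphere (0 : EuclideanSpace ℝ (Fin d)) 1,
        Real.cos (inner ℝ x (η : EuclideanSpace ℝ (Fin d)))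
        ∂(volume : Measure (EuclideanSpace ℝ (Fin d))).toSphere =
      2 * √Real.pi ^ d / Real.Gamma (d / 2) * Omega d ‖x‖ := by
  have hsum := hasSum_integral_cos (volume : Measure (EuclideanSpace ℝ (Fin d))).toSphere
    (f := fun η => inner ℝ x (η : EuclideanSpace ℝ (Fin d)))
    (Continuous.aestronglyMeasurable (by fun_prop)) (C := ‖x‖) fun η => by
      simpa using abs_real_inner_le_norm x (η : EuclideanSpace ℝ (Fin d))
  rw [← hsum.tsum_eq, Omega, ← tsum_mul_left]
  refine tsum_congr fun n => ?_
  have hpos : 0 < Real.Gamma ((d : ℝ) / 2 + n) := Real.Gamma_pos_of_pos (by positivity)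
  have hpos' : 0 < Real.Gamma ((d : ℝ) / 2) := Real.Gamma_pos_of_pos (by positivity)
  have hfac := Real.Gamma_nat_add_half_mul n
  simp only [mul_div_assoc, integral_const_mul, integral_div, integral_toSphere_inner_pow hd]
  have hpi : √Real.pi ^ d = √Real.pi ^ (d - 1) * √Real.pi := (pow_sub_one_mul hd.ne' _).symm
  rw [neg_eq_neg_one_mul (‖x‖ ^ 2 / 4), mul_pow (-1), div_pow, ← pow_mul, hpi]
  generalize Real.Gamma ((d : ℝ) / 2 + n) = A at *
  generalize Real.Gamma ((d : ℝ) / 2) = B at *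
  generalize Real.Gamma ((n : ℝ) + 1 / 2) = C at *
  generalize √Real.pi ^ (d - 1) = D at *
  field_simp
  linear_combination ‖x‖ ^ (2 * n) * D * hfac

theorem Omega_zero {d : ℕ} (hd : 0 < d) : Omega d 0 = 1 := by
  have hpos' : 0 < Real.Gamma ((d : ℝ) / 2) := Real.Gamma_pos_of_pos (by positivity)
  rw [Omega, tsum_eq_single 0 fun n hn => by simp [hn]]
  simp [hpos'.ne']

theorem exists_probabilityMeasure_integral_cos_inner_eq_Omega {d : ℕ} (hd : 0 < d) :
    ∃ ν : Measure (EuclideanSpace ℝ (Fin d)), IsProbabilityMeasure ν ∧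
      ∀ x, ∫ y, Real.cos (inner ℝ x y) ∂ν = Omega d ‖x‖ := by
  have : Nonempty (Fin d) := ⟨⟨0, hd⟩⟩
  let σ := (volume : Measure (EuclideanSpace ℝ (Fin d))).toSphere
  have : NeZero σ := ⟨Measure.toSphere_ne_zero _⟩
  have hσ : σ.real Set.univ = 2 * √Real.pi ^ d / Real.Gamma (d / 2) := by
    simpa only [inner_zero_left, Real.cos_zero, integral_const, smul_eq_mul, norm_zero,
      Omega_zero hd, mul_one] using integral_toSphere_cos_inner hd 0
  refine ⟨((σ Set.univ)⁻¹ • σ).map Subtype.val,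
    Measure.isProbabilityMeasure_map (by fun_prop), fun x => ?_⟩
  have hne : σ.real Set.univ ≠ 0 := by simp [measureReal_eq_zero_iff, NeZero.ne]
  rw [integral_map (by fun_prop) (by fun_prop), integral_smul_measure,
    integral_toSphere_cos_inner hd, ← hσ, ENNReal.toReal_inv, ← measureReal_def, smul_eq_mul,
    inv_mul_cancel_left₀ hne]

theorem abs_Omega_le_one {d : ℕ} (hd : 0 < d) (r : ℝ) : |Omega d r| ≤ 1 := by
  obtain ⟨ν, _, hν⟩ := exists_probabilityMeasure_integral_cos_inner_eq_Omega hd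
  have h : Omega d r = Omega d ‖EuclideanSpace.single (⟨0, hd⟩ : Fin d) r‖ := by
    simp [Omega]
  rw [h, ← hν, ← Real.norm_eq_abs]
  simpa using norm_integral_le_of_norm_le_const (μ := ν) (C := 1)
    (.of_forall fun y => (Real.norm_eq_abs _).trans_le
      (Real.abs_cos_le_one (inner ℝ (EuclideanSpace.single (⟨0, hd⟩ : Fin d) r) y)))

theorem continuous_Omega {d : ℕ} (hd : 0 < d) : Continuous (Omega d) := by
  obtain ⟨ν, _, hν⟩ := exists_probabilityMeasure_integral_cos_inner_eq_Omega hd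
  have h : Omega d = fun r => ∫ y, Real.cos (inner ℝ (EuclideanSpace.single (⟨0, hd⟩ : Fin d) r) y)
      ∂ν := by
    ext r
    rw [hν]
    simp [Omega]
  rw [h]
  refine continuous_of_dominated (bound := fun _ => 1)
    (fun r => Continuous.aestronglyMeasurable (by fun_prop))
    (fun r => .of_forall fun y => Real.abs_cos_le_one _) (integrable_const _)
    (.of_forall fun y => ?_)
  simp only [EuclideanSpace.inner_single_left, conj_trivial]
  fun_prop

theorem posSemidef_Omega_dist_mul {d : ℕ} (hd : 0 < d) {ι : Type*} [Fintype ι]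
    (x : ι → EuclideanSpace ℝ (Fin d)) (r : ℝ) :
    (Matrix.of fun i j => Omega d (dist (x i) (x j) * r)).PosSemidef := by
  obtain ⟨ν, _, hν⟩ := exists_probabilityMeasure_integral_cos_inner_eq_Omega hd
  refine .of_dotProduct_mulVec_nonneg ?_ fun c => ?_
  · ext i j
    simp [dist_comm]
  have hOmega (i j : ι) : Omega d (dist (x i) (x j) * r) =
      ∫ y, Real.cos (inner ℝ (r • (x i - x j)) y) ∂ν := by
    rw [hν, norm_smul, ← dist_eq_norm]
    simp [Omega, mul_pow, mul_comm]
  have hint (i j : ι) : Integrable (fun y => Real.cos (inner ℝ (r • (x i - x j)) y)) ν :=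
    .of_bound (Continuous.aestronglyMeasurable (by fun_prop)) 1
      (.of_forall fun y => Real.abs_cos_le_one _)
  calc
    0 ≤ ∫ y, ∑ i, ∑ j, c i * (Real.cos (inner ℝ (r • (x i - x j)) y) * c j) ∂ν := by
      refine integral_nonneg fun y => ?_
      calc
        0 ≤ (∑ i, c i * Real.cos (inner ℝ (r • x i) y)) ^ 2 +
            (∑ i, c i * Real.sin (inner ℝ (r • x i) y)) ^ 2 := by positivity
        _ = _ := by
          simp only [sq, Finset.sum_mul_sum, ← Finset.sum_add_distrib]
          refine Finset.sum_congr rfl fun i _ => Finset.sum_congr rfl fun j _ => ?_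
          rw [smul_sub, inner_sub_left, Real.cos_sub]
          ring
    _ = _ := by
      rw [integral_finsetSum _ fun i _ => integrable_finsetSum _ fun j _ =>
        ((hint i j).mul_const _).const_mul _]
      simp only [dotProduct, Matrix.mulVec, Finset.mul_sum, Matrix.of_apply, Pi.star_apply,
        star_trivial, hOmega]
      refine Finset.sum_congr rfl fun i _ => ?_
      rw [integral_finsetSum _ fun j _ => ((hint i j).mul_const _).const_mul _]
      simp only [integral_const_mul, integral_mul_const]

theorem stmt3 (d d' : ℕ) (hd : 0 < d) (hd' : 0 < d')
    (H : Measure (ℝ × ℝ)) [IsProbabilityMeasure H]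
    (hH : H {p : ℝ × ℝ | p.1 < 0 ∨ p.2 < 0} = 0)
    (φ : ℝ → ℝ → ℝ)
    (hφ : ∀ x t, φ x t = ∫ p, Omega d (x * p.1) * Omega d' (t * p.2) ∂H) :
    (∀ (n : ℕ)
       (z : Fin n → EuclideanSpace ℝ (Fin d) × EuclideanSpace ℝ (Fin d'))
       (c : Fin n → ℝ),
       0 ≤ ∑ i, ∑ j, c i * c j *
         φ (dist (z i).1 (z j).1) (dist (z i).2 (z j).2)) ∧
    φ 0 0 = 1 := by
  refine ⟨fun n z c => ?_, by simp [hφ, Omega_zero hd, Omega_zero hd']⟩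
  have hint (a b : ℝ) : Integrable (fun p : ℝ × ℝ => Omega d (a * p.1) * Omega d' (b * p.2)) H := by
    have h := continuous_Omega hd
    have h' := continuous_Omega hd'
    refine .of_bound (Continuous.aestronglyMeasurable (by fun_prop)) 1 (.of_forall fun p => ?_)
    rw [norm_mul]
    exact mul_le_one₀ (abs_Omega_le_one hd _) (norm_nonneg _) (abs_Omega_le_one hd' _)
  simp only [hφ, ← integral_const_mul]
  simp_rw [← integral_finsetSum Finset.univ fun j _ => (hint _ _).const_mul _]
  rw [← integral_finsetSum _ fun i _ => integrable_finsetSum _ fun j _ => (hint _ _).const_mul _]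
  refine integral_nonneg fun p => ?_
  have h := ((posSemidef_Omega_dist_mul hd (fun i => (z i).1) p.1).hadamard
    (posSemidef_Omega_dist_mul hd' (fun i => (z i).2) p.2)).dotProduct_mulVec_nonneg c
  simp only [dotProduct, Matrix.mulVec, Finset.mul_sum, Matrix.hadamard_apply, Matrix.of_apply,
    Pi.star_apply, star_trivial] at h
  refine h.trans_eq (Finset.sum_congr rfl fun i _ => Finset.sum_congr rfl fun j _ => ?_)
  ring
end

section
/- Let φ be continuous on [0,1) × [0,∞), with the kernel ((x,s),(y,t)) ↦ φ(‖x−y‖, ‖s−t‖) positive definite on (B_d × ℝ^{d'})², where B_d is the open ball of radius 1/2 in ℝ^d, and suppose y ↦ φ(x,‖y‖) is absolutely integrable on ℝ^{d'} for each x. Then for every ω ∈ ℝ^{d'}, the function φ_ω(x) := ∫_{ℝ^{d'}} e^{−i⟨ω,y⟩} φ(x,‖y‖) dy is real-valued and the kernel (u,v) ↦ φ_ω(‖u−v‖) is positive definite on B_d × B_d. -/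
open MeasureTheory
open scoped RealInnerProductSpace

/-- The double integral of a bounded measurable kernel with nonnegative double sums is nonnegative:
average the double sums over independent samples. -/
lemma integral_prod_nonneg_of_sum_nonneg {E : Type*} [MeasurableSpace E] (μ : Measure E)
    [IsProbabilityMeasure μ] {K : E × E → ℝ} (hK : Measurable K) {C : ℝ} (hC : ∀ p, |K p| ≤ C)
    (hpos : ∀ (n : ℕ) (x : Fin n → E), 0 ≤ ∑ k, ∑ l, K (x k, x l)) :
    0 ≤ ∫ p, K p ∂(μ.prod μ) := by
  set I := ∫ p, K p ∂(μ.prod μ) with hI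
  have hint (n : ℕ) (k l : Fin n) :
      Integrable (fun x : Fin n → E => K (x k, x l)) (Measure.pi fun _ => μ) :=
    Integrable.of_bound (hK.comp ((measurable_pi_apply k).prodMk
      (measurable_pi_apply l))).aestronglyMeasurable C (ae_of_all _ fun x => hC _)
  have hoff (n : ℕ) (k l : Fin n) (hkl : k ≠ l) :
      ∫ x : Fin n → E, K (x k, x l) ∂(Measure.pi fun _ => μ) = I := by
    have hind := (ProbabilityTheory.iIndepFun_pi (μ := fun _ : Fin n => μ)
      (X := fun _ => id) fun _ => aemeasurable_id).indepFun hkl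
    have hmap := (ProbabilityTheory.indepFun_iff_map_prod_eq_prod_map_map
      (measurable_pi_apply k).aemeasurable (measurable_pi_apply l).aemeasurable).1 hind
    have he (i : Fin n) : Measure.map (fun x : Fin n → E => x i) (Measure.pi fun _ => μ) = μ :=
      (measurePreserving_eval (fun _ : Fin n => μ) i).map_eq
    rw [he, he] at hmap
    rw [hI, ← hmap, integral_map ((measurable_pi_apply k).prodMk (measurable_pi_apply l)).aemeasurable
      hK.aestronglyMeasurable]
  have hdiag (n : ℕ) (k : Fin n) :
      ∫ x : Fin n → E, K (x k, x k) ∂(Measure.pi fun _ => μ) ≤ C := by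
    calc _ ≤ ∫ _ : Fin n → E, C ∂(Measure.pi fun _ => μ) :=
          integral_mono (hint n k k) (integrable_const C) fun x => (le_abs_self _).trans (hC _)
      _ = C := by simp
  have hsum (n : ℕ) : 0 ≤ (n : ℝ) * (C + (n - 1) * I) := by
    have h0 : 0 ≤ ∫ x : Fin n → E, ∑ k, ∑ l, K (x k, x l) ∂(Measure.pi fun _ => μ) :=
      integral_nonneg fun x => hpos n x
    rw [integral_finsetSum _ fun k _ => integrable_finsetSum _ fun l _ => hint n k l] at h0
    refine h0.trans ?_
    have hrow (k : Fin n) :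
        ∫ x : Fin n → E, ∑ l, K (x k, x l) ∂(Measure.pi fun _ => μ) ≤ C + (n - 1) * I := by
      rw [integral_finsetSum _ fun l _ => hint n k l, ← Finset.add_sum_erase _ _ (Finset.mem_univ k),
        Finset.sum_congr rfl fun l hl => hoff n k l (Finset.ne_of_mem_erase hl).symm]
      have hn : 1 ≤ n := Fin.pos k
      simpa [Finset.card_erase_of_mem, Nat.cast_sub hn] using hdiag n k
    exact (Finset.sum_le_sum fun k (_ : k ∈ Finset.univ) => hrow k).trans_eq (by simp [mul_add])
  by_contra! hneg
  obtain ⟨n, hn⟩ := exists_nat_gt (C / -I)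
  rw [div_lt_iff₀ (by linarith)] at hn
  have h1 := hsum (n + 1)
  push_cast at h1
  have : 0 ≤ C + ((n : ℝ) + 1 - 1) * I := by
    refine nonneg_of_mul_nonneg_right h1 (by positivity)
  nlinarith

section

variable {E : Type*} [NormedAddCommGroup E] [InnerProductSpace ℝ E] [FiniteDimensional ℝ E]
  [MeasurableSpace E] [BorelSpace E]

lemma integral_rexp_neg_mul_sq_norm_pos {b : ℝ} (hb : 0 < b) :
    0 < ∫ x : E, Real.exp (-b * ‖x‖ ^ 2) := by
  rw [GaussianFourier.integral_rexp_neg_mul_sq_norm hb]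
  positivity

lemma integrable_rexp_neg_mul_sq_norm {b : ℝ} (hb : 0 < b) :
    Integrable fun x : E => Real.exp (-b * ‖x‖ ^ 2) :=
  Integrable.of_integral_ne_zero (integral_rexp_neg_mul_sq_norm_pos hb).ne'

/-- Gaussian weights turn a double integral of `G (x - y)` into a Gaussian average of `G`. -/
lemma integral_integral_gaussian_mul_sub {G : E → ℝ} (hG : Integrable G) {b : ℝ} (hb : 0 < b) :
    ∫ x : E, ∫ y : E, Real.exp (-b * ‖x‖ ^ 2) * (Real.exp (-b * ‖y‖ ^ 2) * G (x - y)) =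
      (∫ x : E, Real.exp (-(2 * b) * ‖x‖ ^ 2)) * ∫ z : E, Real.exp (-(b / 2) * ‖z‖ ^ 2) * G z := by
  have hshift (x : E) :
      ∫ y : E, Real.exp (-b * ‖x‖ ^ 2) * (Real.exp (-b * ‖y‖ ^ 2) * G (x - y)) =
        ∫ z : E, Real.exp (-b * ‖x - z‖ ^ 2) * (Real.exp (-b * ‖x‖ ^ 2) * G z) := by
    rw [← integral_sub_left_eq_self _ volume x]
    refine integral_congr_ae (ae_of_all _ fun z => ?_)
    simp only [sub_sub_cancel]
    ring
  simp_rw [hshift]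
  rw [integral_integral_swap, ← integral_const_mul]
  · refine integral_congr_ae (ae_of_all _ fun z => ?_)
    have hsq (x : E) : Real.exp (-b * ‖x - z‖ ^ 2) * (Real.exp (-b * ‖x‖ ^ 2) * G z) =
        Real.exp (-(2 * b) * ‖x - (1 / 2 : ℝ) • z‖ ^ 2) *
          (Real.exp (-(b / 2) * ‖z‖ ^ 2) * G z) := by
      rw [← mul_assoc, ← mul_assoc, ← Real.exp_add, ← Real.exp_add]
      congr 2
      rw [norm_sub_sq_real, norm_sub_sq_real, norm_smul, inner_smul_right, mul_pow]
      norm_num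
      ring
    simp_rw [hsq]
    rw [integral_mul_const, integral_sub_right_eq_self
      (fun x : E => Real.exp (-(2 * b) * ‖x‖ ^ 2)) ((1 / 2 : ℝ) • z)]
  · refine Integrable.bdd_mul (c := 1) ((integrable_rexp_neg_mul_sq_norm hb).mul_prod hG)
      (by fun_prop) (ae_of_all _ fun p => ?_)
    rw [Real.norm_eq_abs, Real.abs_exp, Real.exp_le_one_iff]
    nlinarith [sq_nonneg ‖p.1 - p.2‖]

/-- The total integral of an integrable continuous even positive definite function is
nonnegative. -/
lemma integral_nonneg_of_posDef {G : E → ℝ} (hcont : Continuous G) (hG : Integrable G)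
    (heven : ∀ x, G (-x) = G x)
    (hpd : ∀ (n : ℕ) (x : Fin n → E) (c : Fin n → ℝ),
      0 ≤ ∑ k, ∑ l, c k * c l * G (x k - x l)) :
    0 ≤ ∫ x, G x := by
  have hbound (z : E) : |G z| ≤ G 0 := by
    have h1 := hpd 2 ![z, 0] ![1, 1]
    have h2 := hpd 2 ![z, 0] ![1, -1]
    simp [Fin.sum_univ_two, heven] at h1 h2
    rw [abs_le]
    constructor <;> linarith
  have hgauss (b : ℝ) (hb : 0 < b) : 0 ≤ ∫ z : E, Real.exp (-(b / 2) * ‖z‖ ^ 2) * G z := by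
    set Z := ∫ x : E, Real.exp (-b * ‖x‖ ^ 2) with hZ
    have hZpos : 0 < Z := integral_rexp_neg_mul_sq_norm_pos hb
    set w : E → ℝ := fun x => Real.exp (-b * ‖x‖ ^ 2) / Z with hw
    have hw0 (x : E) : 0 ≤ w x := by positivity
    have hwm : Measurable w := by fun_prop
    have hwi : Integrable w := (integrable_rexp_neg_mul_sq_norm hb).div_const Z
    set μ : Measure E := volume.withDensity fun x => ENNReal.ofReal (w x) with hμ
    have : IsProbabilityMeasure μ := by
      refine ⟨?_⟩
      rw [hμ, withDensity_apply _ MeasurableSet.univ, Measure.restrict_univ,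
        ← ofReal_integral_eq_lintegral_ofReal hwi (ae_of_all _ hw0), hw, integral_div, ← hZ,
        div_self hZpos.ne', ENNReal.ofReal_one]
    have hK := integral_prod_nonneg_of_sum_nonneg μ (K := fun p => G (p.1 - p.2))
      (by fun_prop) (fun p => hbound _) fun n x => by simpa using hpd n x fun _ => 1
    rw [integral_prod _ (Integrable.of_bound (by fun_prop) (G 0) (ae_of_all _ fun p => hbound _))]
      at hK
    have hdens (f : E → ℝ) : ∫ x, f x ∂μ = ∫ x, w x * f x := by
      rw [hμ, integral_withDensity_eq_integral_toReal_smul (by fun_prop) (by simp)]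
      simp [ENNReal.toReal_ofReal (hw0 _)]
    simp_rw [hdens, ← integral_const_mul] at hK
    have hfac : ∫ x : E, ∫ y : E, w x * (w y * G (x - y)) = (Z⁻¹ * Z⁻¹) *
        ∫ x : E, ∫ y : E, Real.exp (-b * ‖x‖ ^ 2) * (Real.exp (-b * ‖y‖ ^ 2) * G (x - y)) := by
      simp_rw [← integral_const_mul]
      refine integral_congr_ae (ae_of_all _ fun x => integral_congr_ae (ae_of_all _ fun y => ?_))
      simp only [hw, div_eq_mul_inv]
      ring
    rw [hfac, integral_integral_gaussian_mul_sub hG hb, ← mul_assoc] at hK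
    have h2 : 0 < ∫ x : E, Real.exp (-(2 * b) * ‖x‖ ^ 2) :=
      integral_rexp_neg_mul_sq_norm_pos (by positivity)
    exact nonneg_of_mul_nonneg_right hK (by positivity)
  have hlim : Filter.Tendsto
      (fun n : ℕ => ∫ z : E, Real.exp (-((1 / ((n : ℝ) + 1)) / 2) * ‖z‖ ^ 2) * G z)
      Filter.atTop (nhds (∫ z, G z)) := by
    refine tendsto_integral_of_dominated_convergence (fun z => |G z|)
      (fun n => by fun_prop) hG.abs (fun n => ae_of_all _ fun z => ?_) (ae_of_all _ fun z => ?_)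
    · rw [norm_mul, Real.norm_eq_abs, Real.norm_eq_abs, Real.abs_exp]
      refine mul_le_of_le_one_left (abs_nonneg _) (Real.exp_le_one_iff.2 ?_)
      rw [neg_mul]
      exact neg_nonpos.2 (by positivity)
    · have h := tendsto_one_div_add_atTop_nhds_zero_nat (𝕜 := ℝ)
      have h' := ((Real.continuous_exp.tendsto _).comp
        (((h.div_const 2).neg).mul_const (‖z‖ ^ 2))).mul_const (G z)
      simpa using h'
  exact ge_of_tendsto' hlim fun n => hgauss _ (by positivity)

end

lemma sum_fintype_nonneg_of_sum_fin_nonneg {X ι : Type*} [Fintype ι] {P : X → Prop}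
    {K : X → X → ℝ}
    (h : ∀ (n : ℕ) (z : Fin n → X), (∀ i, P (z i)) → ∀ c : Fin n → ℝ,
      0 ≤ ∑ i, ∑ j, c i * c j * K (z i) (z j))
    (z : ι → X) (hz : ∀ i, P (z i)) (c : ι → ℝ) :
    0 ≤ ∑ i, ∑ j, c i * c j * K (z i) (z j) := by
  have := h _ (z ∘ (Fintype.equivFin ι).symm) (fun i => hz _) (c ∘ (Fintype.equivFin ι).symm)
  simp only [Function.comp_apply] at this
  rw [← (Fintype.equivFin ι).symm.sum_comp]
  simp_rw [← (Fintype.equivFin ι).symm.sum_comp (fun j => c _ * c j * K _ (z j))]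
  exact this

section

variable {F : Type*} [NormedAddCommGroup F] [InnerProductSpace ℝ F] [FiniteDimensional ℝ F]
  [MeasurableSpace F] [BorelSpace F]

/-- The Fourier transform of a radial function is its cosine transform. -/
lemma integral_cexp_mul_radial {f : ℝ → ℝ} (hf : Integrable fun y : F => f ‖y‖) (ω : F) :
    ∫ y : F, Complex.exp (-Complex.I * (⟪ω, y⟫ : ℝ)) * (f ‖y‖ : ℂ) =
      ((∫ y : F, Real.cos ⟪ω, y⟫ * f ‖y‖ : ℝ) : ℂ) := by
  have hcos : Integrable fun y : F => Real.cos ⟪ω, y⟫ * f ‖y‖ :=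
    hf.bdd_mul (c := 1) (by fun_prop) (ae_of_all _ fun y => Real.abs_cos_le_one _)
  have hsin : Integrable fun y : F => Real.sin ⟪ω, y⟫ * f ‖y‖ :=
    hf.bdd_mul (c := 1) (by fun_prop) (ae_of_all _ fun y => Real.abs_sin_le_one _)
  have hodd : ∫ y : F, Real.sin ⟪ω, y⟫ * f ‖y‖ = 0 := by
    have h := integral_neg_eq_self (fun y : F => Real.sin ⟪ω, y⟫ * f ‖y‖) volume
    simp only [inner_neg_right, Real.sin_neg, norm_neg, neg_mul, integral_neg] at h
    linarith
  have hexp (y : F) : Complex.exp (-Complex.I * (⟪ω, y⟫ : ℝ)) * (f ‖y‖ : ℂ) =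
      ((Real.cos ⟪ω, y⟫ * f ‖y‖ : ℝ) : ℂ) - Complex.I * ((Real.sin ⟪ω, y⟫ * f ‖y‖ : ℝ) : ℂ) := by
    rw [show -Complex.I * ((⟪ω, y⟫ : ℝ) : ℂ) = ((-⟪ω, y⟫ : ℝ) : ℂ) * Complex.I by push_cast; ring,
      Complex.exp_mul_I, ← Complex.ofReal_cos, ← Complex.ofReal_sin, Real.cos_neg, Real.sin_neg]
    push_cast
    ring
  simp_rw [hexp]
  rw [integral_sub hcos.ofReal (hsin.ofReal.const_mul _), integral_const_mul,
    integral_complex_ofReal, integral_complex_ofReal, hodd]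
  simp

lemma sum_integral_cos_mul_radial_nonneg {X : Type*} [PseudoMetricSpace X] {P : X → Prop}
    (φ : ℝ → ℝ → ℝ)
    (hpd : ∀ (n : ℕ) (z : Fin n → X × F), (∀ i, P (z i).1) → ∀ c : Fin n → ℝ,
      0 ≤ ∑ i, ∑ j, c i * c j * φ (dist (z i).1 (z j).1) (dist (z i).2 (z j).2))
    {n : ℕ} (u : Fin n → X) (hu : ∀ i, P (u i))
    (hcont : ∀ i j, Continuous fun y : F => φ (dist (u i) (u j)) ‖y‖)
    (hint : ∀ i j, Integrable fun y : F => φ (dist (u i) (u j)) ‖y‖)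
    (a : Fin n → ℝ) (ω : F) :
    0 ≤ ∑ i, ∑ j, a i * a j * ∫ y : F, Real.cos ⟪ω, y⟫ * φ (dist (u i) (u j)) ‖y‖ := by
  have hcos (i j : Fin n) : Integrable fun y : F =>
      a i * a j * (Real.cos ⟪ω, y⟫ * φ (dist (u i) (u j)) ‖y‖) :=
    ((hint i j).bdd_mul (c := 1) (by fun_prop)
      (ae_of_all _ fun y => Real.abs_cos_le_one _)).const_mul _
  simp_rw [← integral_const_mul]
  simp_rw [← integral_finsetSum _ fun j _ => hcos _ j]
  rw [← integral_finsetSum _ fun i _ => integrable_finsetSum _ fun j _ => hcos i j]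
  refine integral_nonneg_of_posDef ?_ ?_ (fun y => by simp) fun m x e => ?_
  · exact continuous_finsetSum _ fun i _ => continuous_finsetSum _ fun j _ =>
      continuous_const.mul (Continuous.mul (by fun_prop) (hcont i j))
  · exact integrable_finsetSum _ fun i _ => integrable_finsetSum _ fun j _ => hcos i j
  · have hweighted (g : F → ℝ) := sum_fintype_nonneg_of_sum_fin_nonneg (ι := Fin m × Fin n)
      (P := fun p : X × F => P p.1) (K := fun p q => φ (dist p.1 q.1) (dist p.2 q.2)) hpd
      (fun p => (u p.2, x p.1)) (fun p => hu p.2) (fun p => e p.1 * g (x p.1) * a p.2)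
    refine (add_nonneg (hweighted fun y => Real.cos ⟪ω, y⟫)
      (hweighted fun y => Real.sin ⟪ω, y⟫)).trans_eq ?_
    simp only [Fintype.sum_prod_type, ← Finset.sum_add_distrib, Finset.mul_sum, dist_eq_norm (x _)]
    refine Finset.sum_congr rfl fun k _ => ?_
    rw [Finset.sum_comm]
    refine Finset.sum_congr rfl fun l _ => Finset.sum_congr rfl fun i _ =>
      Finset.sum_congr rfl fun j _ => ?_
    rw [inner_sub_right, Real.cos_sub]
    ring

end

theorem stmt5 (d d' : ℕ) (hd : 0 < d) (hd' : 0 < d') (φ : ℝ → ℝ → ℝ)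
    (hcont : ContinuousOn (fun p : ℝ × ℝ => φ p.1 p.2)
      (Set.Ico 0 1 ×ˢ Set.Ici 0))
    (hint : ∀ x ∈ Set.Ico (0 : ℝ) 1,
      Integrable (fun y : EuclideanSpace ℝ (Fin d') => φ x ‖y‖))
    (hpd : ∀ (n : ℕ)
      (z : Fin n → EuclideanSpace ℝ (Fin d) × EuclideanSpace ℝ (Fin d')),
      (∀ i, ‖(z i).1‖ < 1 / 2) → ∀ c : Fin n → ℝ,
      0 ≤ ∑ i, ∑ j, c i * c j *
        φ (dist (z i).1 (z j).1) (dist (z i).2 (z j).2)) :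
    ∀ ω : EuclideanSpace ℝ (Fin d'),
      (∀ x ∈ Set.Ico (0 : ℝ) 1,
        (∫ y : EuclideanSpace ℝ (Fin d'),
          Complex.exp (-Complex.I * (⟪ω, y⟫ : ℝ)) * (φ x ‖y‖ : ℂ)).im = 0) ∧
      (∀ (n : ℕ) (u : Fin n → EuclideanSpace ℝ (Fin d)),
        (∀ i, ‖u i‖ < 1 / 2) → ∀ c : Fin n → ℂ,
        0 ≤ (∑ i, ∑ j, c i * (starRingEnd ℂ) (c j) *
          ∫ y : EuclideanSpace ℝ (Fin d'),
            Complex.exp (-Complex.I * (⟪ω, y⟫ : ℝ)) *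
              (φ (dist (u i) (u j)) ‖y‖ : ℂ)).re) := by
  intro ω
  refine ⟨fun x hx => ?_, fun n u hu c => ?_⟩
  · rw [integral_cexp_mul_radial (hint x hx), Complex.ofReal_im]
  have hdist (i j : Fin n) : dist (u i) (u j) ∈ Set.Ico (0 : ℝ) 1 :=
    ⟨dist_nonneg, by
      rw [dist_eq_norm]
      linarith [norm_sub_le (u i) (u j), hu i, hu j]⟩
  have hradial (i j : Fin n) :
      Continuous fun y : EuclideanSpace ℝ (Fin d') => φ (dist (u i) (u j)) ‖y‖ :=
    hcont.comp_continuous (f := fun y => (dist (u i) (u j), ‖y‖)) (by fun_prop)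
      fun y => ⟨hdist i j, norm_nonneg y⟩
  have hreal := sum_integral_cos_mul_radial_nonneg (P := fun v => ‖v‖ < 1 / 2) φ hpd u hu hradial
    fun i j => hint _ (hdist i j)
  refine (add_nonneg (hreal (fun i => (c i).re) ω) (hreal (fun i => (c i).im) ω)).trans_eq ?_
  simp_rw [integral_cexp_mul_radial (hint _ (hdist _ _)), Complex.re_sum, ← Finset.sum_add_distrib]
  refine Finset.sum_congr rfl fun i _ => Finset.sum_congr rfl fun j _ => ?_
  simp [Complex.mul_re]
  ring
end
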